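/- If the message distribution P_U is not uniform on its support, then in any error-free perfect secrecy system both H(X) and H(R) are strictly greater than H(U). -/

import Mathlib

open Finset

/-- Shannon entropy of a finitely supported probability mass function. -/
noncomputable def ent {α : Type*} [Fintype α] (q : α → ℝ) : ℝ :=
  ∑ a, Real.negMulLog (q a)

theorem ent_key {U R X : Type*} [Fintype U] [Fintype R] [Fintype X]
    (p : U → R → X → ℝ) (a : U → ℝ) (b : R → ℝ) (c : X → ℝ)
    (ha : ∀ u, a u = ∑ r, ∑ x, p u r x)
    (hb : ∀ r, b r = ∑ u, ∑ x, p u r x)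
    (hc : ∀ x, c x = ∑ u, ∑ r, p u r x)
    (hnn : ∀ u r x, 0 ≤ p u r x)
    (hsum : ∑ u, a u = 1)
    (hIUX : ∀ u x, (∑ r, p u r x) = a u * c x)
    (hIUR : ∀ u r, (∑ x, p u r x) = a u * b r)
    (hdet : ∃ g : R → X → U, ∀ u r x, p u r x ≠ 0 → u = g r x)
    (hnonunif : ∃ u₁ u₂ : U, a u₁ ≠ 0 ∧ a u₂ ≠ 0 ∧ a u₁ ≠ a u₂) :
    ent a < ent b := by
  classical
  obtain ⟨g, hg⟩ := hdet
  obtain ⟨u₁, u₂, h1, h2, h12⟩ := hnonunif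
  have ha0 : ∀ u, 0 ≤ a u := fun u => by
    rw [ha]; exact sum_nonneg fun r _ => sum_nonneg fun x _ => hnn u r x
  have hb0 : ∀ r, 0 ≤ b r := fun r => by
    rw [hb]; exact sum_nonneg fun u _ => sum_nonneg fun x _ => hnn u r x
  have hc0 : ∀ x, 0 ≤ c x := fun x => by
    rw [hc]; exact sum_nonneg fun u _ => sum_nonneg fun r _ => hnn u r x
  have hsb : ∑ r, b r = 1 := by
    rw [← hsum]; simp_rw [hb, ha]; exact sum_comm
  have hsc : ∑ x, c x = 1 := by
    rw [← hsum]; simp_rw [hc, ha]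
    rw [sum_comm]; exact sum_congr rfl fun u _ => sum_comm
  have hpx : ∀ u r x, p u r x ≤ a u * c x := fun u r x => by
    rw [← hIUX]
    exact single_le_sum (f := fun r => p u r x) (fun r _ => hnn u r x) (mem_univ r)
  have hpr : ∀ u r x, p u r x ≤ a u * b r := fun u r x => by
    rw [← hIUR]
    exact single_le_sum (f := fun x => p u r x) (fun x _ => hnn u r x) (mem_univ x)
  have hpos : ∀ u r x, p u r x ≠ 0 → 0 < p u r x ∧ 0 < a u ∧ 0 < b r := fun u r x h => by
    have hp := lt_of_le_of_ne (hnn u r x) (Ne.symm h)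
    have hab := hp.trans_le (hpr u r x)
    refine ⟨hp, lt_of_le_of_ne (ha0 u) ?_, lt_of_le_of_ne (hb0 r) ?_⟩
    · intro h; rw [← h] at hab; simp at hab
    · intro h; rw [← h] at hab; simp at hab
  have hmain : ∀ u r x, p u r x * (b r / a u) ≤ if u = g r x then b r * c x else 0 := by
    intro u r x
    by_cases h : p u r x = 0
    · rw [h, zero_mul]; split_ifs
      · exact mul_nonneg (hb0 r) (hc0 x)
      · exact le_rfl
    · obtain ⟨_, hau, hbr⟩ := hpos u r x h
      rw [if_pos (hg u r x h)]
      calc p u r x * (b r / a u) ≤ (a u * c x) * (b r / a u) :=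
            mul_le_mul_of_nonneg_right (hpx u r x) (div_nonneg hbr.le hau.le)
        _ = b r * c x := by field_simp
  have hle : ∀ u r x, p u r x - (if u = g r x then b r * c x else 0)
      ≤ p u r x * (Real.log (a u) - Real.log (b r)) := by
    intro u r x
    have hm := hmain u r x
    by_cases h : p u r x = 0
    · rw [h] at hm ⊢; linarith
    · obtain ⟨hp, hau, hbr⟩ := hpos u r x h
      have hl := Real.log_le_sub_one_of_pos (div_pos hbr hau)
      rw [Real.log_div hbr.ne' hau.ne'] at hl
      nlinarith
  have hlt : ∀ u r x, p u r x ≠ 0 → a u ≠ b r →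
      p u r x - (if u = g r x then b r * c x else 0)
      < p u r x * (Real.log (a u) - Real.log (b r)) := by
    intro u r x h hne
    have hm := hmain u r x
    obtain ⟨hp, hau, hbr⟩ := hpos u r x h
    have hl := Real.log_lt_sub_one_of_pos (div_pos hbr hau) (by
      intro h'; rw [div_eq_one_iff_eq hau.ne'] at h'; exact hne h'.symm)
    rw [Real.log_div hbr.ne' hau.ne'] at hl
    nlinarith
  obtain ⟨r₀, hr₀⟩ : ∃ r, b r ≠ 0 := by
    by_contra! h
    simp [h] at hsb
  have hex : ∀ u, a u ≠ 0 → ∃ x, p u r₀ x ≠ 0 := by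
    intro u hu
    by_contra! h
    have := hIUR u r₀
    simp [h, hu, hr₀] at this
  obtain ⟨u₀, x₀, hp0, hne0⟩ : ∃ u x, p u r₀ x ≠ 0 ∧ a u ≠ b r₀ := by
    by_cases h : a u₁ = b r₀
    · obtain ⟨x, hx⟩ := hex u₂ h2
      exact ⟨u₂, x, hx, fun h' => h12 (h.trans h'.symm)⟩
    · obtain ⟨x, hx⟩ := hex u₁ h1
      exact ⟨u₁, x, hx, h⟩
  have hS : ∑ t : U × R × X, (p t.1 t.2.1 t.2.2
        - (if t.1 = g t.2.1 t.2.2 then b t.2.1 * c t.2.2 else 0))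
      < ∑ t : U × R × X, p t.1 t.2.1 t.2.2 * (Real.log (a t.1) - Real.log (b t.2.1)) :=
    sum_lt_sum (fun t _ => hle _ _ _) ⟨(u₀, r₀, x₀), mem_univ _, hlt _ _ _ hp0 hne0⟩
  have hA : ∑ t : U × R × X, p t.1 t.2.1 t.2.2 = 1 := by
    simp_rw [Fintype.sum_prod_type, ← ha]; exact hsum
  have hB : ∑ t : U × R × X, (if t.1 = g t.2.1 t.2.2 then b t.2.1 * c t.2.2 else 0) = 1 := by
    rw [Fintype.sum_prod_type, sum_comm, Fintype.sum_prod_type]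
    simp [← mul_sum, hsc, hsb]
  have hC : ∑ t : U × R × X, p t.1 t.2.1 t.2.2 * Real.log (a t.1) = - ent a := by
    simp_rw [Fintype.sum_prod_type, ← sum_mul, ← ha]
    simp [ent, Real.negMulLog]
  have hD : ∑ t : U × R × X, p t.1 t.2.1 t.2.2 * Real.log (b t.2.1) = - ent b := by
    simp_rw [Fintype.sum_prod_type]
    rw [sum_comm]
    simp_rw [← sum_mul, ← hb]
    simp [ent, Real.negMulLog]
  simp_rw [mul_sub] at hS
  rw [sum_sub_distrib, sum_sub_distrib, hA, hB, hC, hD] at hS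
  linarith

/-- If the source distribution is not uniform on its support, then in any
error-free perfect secrecy system both `H(X)` and `H(R)` are strictly greater
than `H(U)`. -/
theorem stmt_4 {𝒰 ℛ 𝒳 : Type*} [Fintype 𝒰] [Fintype ℛ] [Fintype 𝒳]
    (p : 𝒰 → ℛ → 𝒳 → ℝ)
    (hnn : ∀ u r x, 0 ≤ p u r x)
    (hsum : ∑ u, ∑ r, ∑ x, p u r x = 1)
    (hIUX : ∀ u x, (∑ r, p u r x)
      = (∑ r, ∑ x', p u r x') * (∑ u', ∑ r, p u' r x))
    (hIUR : ∀ u r, (∑ x, p u r x)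
      = (∑ r', ∑ x, p u r' x) * (∑ u', ∑ x, p u' r x))
    (hdet : ∃ g : ℛ → 𝒳 → 𝒰, ∀ u r x, p u r x ≠ 0 → u = g r x)
    -- `P_U` is not uniform on its support
    (hnonunif : ∃ u₁ u₂ : 𝒰, (∑ r, ∑ x, p u₁ r x) ≠ 0 ∧ (∑ r, ∑ x, p u₂ r x) ≠ 0 ∧
      (∑ r, ∑ x, p u₁ r x) ≠ (∑ r, ∑ x, p u₂ r x)) :
    ent (fun u => ∑ r, ∑ x, p u r x) < ent (fun x => ∑ u, ∑ r, p u r x)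
      ∧ ent (fun u => ∑ r, ∑ x, p u r x) < ent (fun r => ∑ u, ∑ x, p u r x) := by
  constructor
  · have hsw : ∀ u, ∑ r, ∑ x, p u r x = ∑ x, ∑ r, p u r x := fun u => sum_comm
    exact ent_key (fun u x r => p u r x) _ _ (fun r => ∑ u, ∑ x, p u r x)
      hsw (fun _ => rfl) (fun _ => rfl) (fun u x r => hnn u r x) hsum hIUR hIUX
      (by obtain ⟨g, hg⟩ := hdet; exact ⟨fun x r => g r x, fun u x r h => hg u r x h⟩) hnonunif
  · exact ent_key p _ _ (fun x => ∑ u, ∑ r, p u r x)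
      (fun _ => rfl) (fun _ => rfl) (fun _ => rfl) hnn hsum hIUX hIUR hdet hnonunif
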